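/- Let β, γ ∈ (0,1), δ > 0, 0 < c⁻ < c⁺, r ≥ (1−β)·c⁺·δ/(1−γ), c⁻ ≥ max{ (1 + βγ/2)·(1−βγ)·c⁺, βγ·(1−β²γ²)·c⁺ }, L ≥ 2, and μ_l = δ·(l−1)/(1−γ) for l = 1,…,L. Let 𝓕 be the set of continuous, nondecreasing-in-x functions F : {1,…,L} × [0,μ_L] → ℝ such that (Pa) F(l,·) is (1−β^kγ^k)·c⁺-Lipschitz on [μ_{l−k−1}, μ_{l−k}] for each k = 0,…,l−1 (with μ₀ := 0; k = 0 means F(l,·) is constant on [μ_{l−1}, μ_l]), and (Pb) F(l, μ_l) ≥ F(l+1, μ_{l+1}) for all l ∈ {1,…,L−1}. Then the multi-level Bellman operator T maps 𝓕 into 𝓕, and for every F ∈ 𝓕, every l ∈ {1,…,L−1}, and every x ∈ [μ_{max(l−1,1)}, μ_{l+1}]: (TF)(l, x) = (1−βγ)·c⁺·μ_{l+1} − (r + β·c⁺·δ)·l + β·F(l+1, μ_{l+1}). -/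

import Mathlib

/-- The multi-level Bellman operator: `(T F)(l, x)` is the infimum over the available
relegation / staying / promotion branches of the one-step cost-to-go. Levels range over
`1,…,L`, attributes over `[0, μ L]`. -/
noncomputable def mlBell (β γ cplus cminus r δ : ℝ) (L : ℕ) (μ : ℕ → ℝ)
    (F : ℕ → ℝ → ℝ) (l : ℕ) (x : ℝ) : ℝ :=
  sInf { v : ℝ |
    (∃ xt u : ℝ, x ≤ xt ∧ xt ≤ μ L ∧ 0 ≤ u ∧ 2 ≤ l ∧ xt + u < μ l ∧
      v = (1 - β * γ) * cplus * xt + cminus * u - (r + β * cplus * δ) * ((l : ℝ) - 2)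
          + β * F (l - 1) (γ * xt + δ * ((l : ℝ) - 2))) ∨
    (∃ xt u : ℝ, x ≤ xt ∧ xt ≤ μ L ∧ 0 ≤ u ∧ μ l ≤ xt + u ∧ (l < L → xt + u < μ (l + 1)) ∧
      v = (1 - β * γ) * cplus * xt + cminus * u - (r + β * cplus * δ) * ((l : ℝ) - 1)
          + β * F l (γ * xt + δ * ((l : ℝ) - 1))) ∨
    (∃ xt u : ℝ, x ≤ xt ∧ xt ≤ μ L ∧ 0 ≤ u ∧ l < L ∧ μ (l + 1) ≤ xt + u ∧
      v = (1 - β * γ) * cplus * xt + cminus * u - (r + β * cplus * δ) * (l : ℝ)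
          + β * F (l + 1) (γ * xt + δ * (l : ℝ)) ) }

/-- The natural threshold sequence `μ_l = δ(l-1)/(1-γ)` (each level's steady-state
attribute), with the convention `μ₀ := 0`. -/
noncomputable def natThresh (γ δ : ℝ) (l : ℕ) : ℝ :=
  if l = 0 then 0 else δ * ((l : ℝ) - 1) / (1 - γ)

/-- Membership in the invariant class `𝓕`: continuous, nondecreasing in `x`,
`(1-β^kγ^k)c⁺`-Lipschitz on each interval `[μ_{l-k-1}, μ_{l-k}]` for `k = 0,…,l-1`
(property (Pa); `k = 0` says constancy on `[μ_{l-1}, μ_l]`), and nonincreasing along the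
diagonal `l ↦ F(l, μ_l)` (property (Pb)). -/
def memInvClass (β γ cplus : ℝ) (L : ℕ) (μ : ℕ → ℝ) (F : ℕ → ℝ → ℝ) : Prop :=
  (∀ l ∈ Finset.Icc 1 L,
    ContinuousOn (F l) (Set.Icc 0 (μ L)) ∧ MonotoneOn (F l) (Set.Icc 0 (μ L)))
  ∧ (∀ l ∈ Finset.Icc 1 L, ∀ k : ℕ, k < l →
      ∀ x ∈ Set.Icc (μ (l - k - 1)) (μ (l - k)), ∀ y ∈ Set.Icc (μ (l - k - 1)) (μ (l - k)),
        |F l x - F l y| ≤ (1 - (β * γ) ^ k) * cplus * |x - y|)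
  ∧ (∀ l : ℕ, 1 ≤ l → l < L → F (l + 1) (μ (l + 1)) ≤ F l (μ l))

structure Hyp (β γ p m r δ s : ℝ) (L : ℕ) : Prop where
  b0 : 0 < β
  b1 : β < 1
  g0 : 0 < γ
  g1 : γ < 1
  s0 : 0 < s
  hd : δ = s * (1 - γ)
  p0 : 0 < p
  m0 : 0 < m
  m1 : (1 + β * γ / 2) * (1 - β * γ) * p ≤ m
  m2 : β * γ * (1 - β ^ 2 * γ ^ 2) * p ≤ m
  hr : (1 - β) * p * s ≤ r
  hL : 2 ≤ L

section
variable {β γ p m r δ s : ℝ} {L : ℕ}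

theorem Hyp.mu (H : Hyp β γ p m r δ s L) {l : ℕ} (hl : 1 ≤ l) :
    natThresh γ δ l = s * ((l : ℝ) - 1) := by
  have h1 : (1 - γ) ≠ 0 := by linarith [H.g1]
  unfold natThresh
  rw [if_neg (by omega), H.hd]
  field_simp

theorem Hyp.mu0 : natThresh γ δ 0 = 0 := by simp [natThresh]

theorem Hyp.a0 (H : Hyp β γ p m r δ s L) : 0 < β * γ := mul_pos H.b0 H.g0
theorem Hyp.a1 (H : Hyp β γ p m r δ s L) : β * γ < 1 := by
  nlinarith [H.b0, H.g0, H.b1, H.g1]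

/-- property (Pa) for one level -/
def PaL (β γ p δ : ℝ) (l : ℕ) (G : ℝ → ℝ) : Prop :=
  ∀ k : ℕ, k < l →
      ∀ x ∈ Set.Icc (natThresh γ δ (l - k - 1)) (natThresh γ δ (l - k)),
      ∀ y ∈ Set.Icc (natThresh γ δ (l - k - 1)) (natThresh γ δ (l - k)),
        |G x - G y| ≤ (1 - (β * γ) ^ k) * p * |x - y|

theorem Hyp.piece (H : Hyp β γ p m r δ s L) {l : ℕ} {G : ℝ → ℝ}
    (hG : PaL β γ p δ l G) (k : ℕ) (hk : k < l) (x y : ℝ) (hx0 : 0 ≤ x) (hxy : x ≤ y)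
    (hy : y ≤ s * ((l : ℝ) - 1) - k * s) (hx : s * ((l : ℝ) - 1) - (k + 1) * s ≤ x) :
    G y - G x ≤ (1 - (β * γ) ^ k) * p * (y - x) := by
  have e1 : natThresh γ δ (l - k) = s * ((l : ℝ) - 1) - k * s := by
    rw [H.mu (by omega), Nat.cast_sub hk.le]; ring
  have e2 : natThresh γ δ (l - k - 1) ≤ x := by
    by_cases h : l - k - 1 = 0
    · rw [h, Hyp.mu0]; exact hx0
    · rw [H.mu (by omega), Nat.cast_sub (by omega), Nat.cast_sub hk.le]; push_cast; linarith
  have := hG k hk y ⟨by linarith, by linarith⟩ x ⟨e2, by linarith⟩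
  rw [abs_of_nonneg (by linarith : 0 ≤ y - x)] at this
  exact (le_abs_self _).trans this

theorem Hyp.powle (H : Hyp β γ p m r δ s L) (k : ℕ) :
    (β * γ) ^ (k + 1) ≤ (β * γ) ^ k :=
  pow_le_pow_of_le_one H.a0.le H.a1.le (Nat.le_succ k)

theorem Hyp.glue (H : Hyp β γ p m r δ s L) {l : ℕ} (hl : 1 ≤ l) {G : ℝ → ℝ}
    (hG : PaL β γ p δ l G) (k : ℕ) : ∀ (x y : ℝ), 0 ≤ x → x ≤ y →
    y ≤ s * ((l : ℝ) - 1) → s * ((l : ℝ) - 1) - (k + 1) * s ≤ x →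
    G y - G x ≤ (1 - (β * γ) ^ k) * p * (y - x) := by
  induction k with
  | zero =>
    intro x y h0 hxy hy hx
    exact H.piece hG 0 (by omega) x y h0 hxy (by simpa using hy) (by simpa using hx)
  | succ k ih =>
    intro x y h0 hxy hy hx
    have hs := H.s0
    have mono : ∀ z : ℝ, 0 ≤ z → (1 - (β * γ) ^ k) * p * z ≤ (1 - (β * γ) ^ (k + 1)) * p * z := by
      intro z hz
      have := H.powle k
      have hp := H.p0
      gcongr
    push_cast at hx
    by_cases hb : s * ((l : ℝ) - 1) - (k + 1) * s ≤ x
    · exact (ih x y h0 hxy hy hb).trans (mono _ (by linarith))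
    push Not at hb
    have hkl : k + 1 < l := by
      by_contra hc
      have : (l : ℝ) ≤ k + 1 := by exact_mod_cast (not_lt.mp hc)
      nlinarith
    by_cases hy2 : y ≤ s * ((l : ℝ) - 1) - (k + 1) * s
    · exact H.piece hG (k + 1) hkl x y h0 hxy (by push_cast; linarith) (by push_cast; linarith)
    push Not at hy2
    have h1 := H.piece hG (k + 1) hkl x (s * ((l : ℝ) - 1) - (k + 1) * s) h0 hb.le
      (by push_cast; linarith) (by push_cast; linarith)
    have h2 := (ih (s * ((l : ℝ) - 1) - (k + 1) * s) y (by linarith) hy2.le hy le_rfl).trans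
      (mono _ (by linarith))
    linarith

/-- the one step map stays in range -/
theorem Hyp.stepeq (H : Hyp β γ p m r δ s L) (j x : ℝ) :
    γ * x + δ * (j - 1) = s * (j - 1) - γ * (s * (j - 1) - x) := by
  rw [H.hd]; ring

theorem Hyp.step_range (H : Hyp β γ p m r δ s L) {j : ℕ} (hj : 1 ≤ j) (hjL : j ≤ L) {x : ℝ}
    (hx : 0 ≤ x) (hxL : x ≤ s * ((L : ℝ) - 1)) :
    γ * x + δ * ((j : ℝ) - 1) ∈ Set.Icc 0 (natThresh γ δ L) := by
  have hs := H.s0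
  have h1 : (1 : ℝ) ≤ j := by exact_mod_cast hj
  have h2 : (j : ℝ) ≤ L := by exact_mod_cast hjL
  have hd : 0 < δ := by rw [H.hd]; exact mul_pos hs (by linarith [H.g1])
  have hg := H.g0
  constructor
  · have : 0 ≤ δ * ((j : ℝ) - 1) := mul_nonneg hd.le (by linarith)
    positivity
  · rw [H.mu (by omega)]
    calc γ * x + δ * ((j : ℝ) - 1) ≤ γ * (s * ((L : ℝ) - 1)) + δ * ((L : ℝ) - 1) := by gcongr
      _ = _ := by rw [H.hd]; ring

/-- basic data of `F` -/
structure FHyp (β γ p δ : ℝ) (L : ℕ) (F : ℕ → ℝ → ℝ) : Prop where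
  cont : ∀ l, 1 ≤ l → l ≤ L → ContinuousOn (F l) (Set.Icc 0 (natThresh γ δ L))
  mono : ∀ l, 1 ≤ l → l ≤ L → MonotoneOn (F l) (Set.Icc 0 (natThresh γ δ L))
  pa : ∀ l, 1 ≤ l → l ≤ L → PaL β γ p δ l (F l)
  pb : ∀ l : ℕ, 1 ≤ l → l < L →
    F (l + 1) (natThresh γ δ (l + 1)) ≤ F l (natThresh γ δ l)

variable {F : ℕ → ℝ → ℝ}

theorem Hyp.mu_range (H : Hyp β γ p m r δ s L) {j : ℕ} (hj : 1 ≤ j) (hjL : j ≤ L) :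
    s * ((j : ℝ) - 1) ∈ Set.Icc 0 (natThresh γ δ L) := by
  have hs := H.s0
  have h1 : (1 : ℝ) ≤ j := by exact_mod_cast hj
  have h2 : (j : ℝ) ≤ L := by exact_mod_cast hjL
  rw [H.mu (by omega)]
  exact ⟨mul_nonneg hs.le (by linarith), by gcongr⟩

theorem Hyp.lemA (H : Hyp β γ p m r δ s L) (hF : FHyp β γ p δ L F) {j : ℕ} (hj : 1 ≤ j)
    (hjL : j ≤ L) {x u : ℝ} (hx : 0 ≤ x) (hxL : x ≤ s * ((L : ℝ) - 1)) (hu : 0 ≤ u)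
    (hxu : s * ((j : ℝ) - 1) ≤ x + u) (hd : s * ((j : ℝ) - 1) - 2 * s ≤ x) :
    (1 - β * γ) * p * (s * ((j : ℝ) - 1)) + β * F j (s * ((j : ℝ) - 1)) ≤
      (1 - β * γ) * p * x + m * u + β * F j (γ * x + δ * ((j : ℝ) - 1)) := by
  have hs := H.s0
  have hg := H.g0
  have hb := H.b0
  have hp := H.p0
  have hm := H.m0
  have ha := H.a1
  have ha0 := H.a0
  have hap : 0 < (1 - β * γ) * p := mul_pos (by linarith) hp
  have hy := H.step_range hj hjL hx hxL
  have hmu := H.mu_range hj hjL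
  have hye := H.stepeq j x
  set M := s * ((j : ℝ) - 1) with hM
  set y := γ * x + δ * ((j : ℝ) - 1) with hydef
  by_cases hc : M ≤ x
  · have h1 : F j M ≤ F j y := by
      apply hF.mono j hj hjL hmu hy
      nlinarith
    have h2 : (1 - β * γ) * p * M ≤ (1 - β * γ) * p * x := by gcongr
    have h3 : β * F j M ≤ β * F j y := by gcongr
    have h4 : 0 ≤ m * u := by positivity
    linarith
  push Not at hc
  have hyM : y ≤ M := by nlinarith
  have hm1 := H.m1
  have hmu' : m * (M - x) ≤ m * u := by gcongr; linarith
  have hmd : (1 + β * γ / 2) * (1 - β * γ) * p * (M - x) ≤ m * (M - x) := by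
    apply mul_le_mul_of_nonneg_right hm1; linarith
  have hpos : 0 ≤ (1 - β * γ) * p * (M - x) := mul_nonneg hap.le (by linarith)
  by_cases hk : M - s ≤ y
  · have h := H.glue hj (hF.pa j hj hjL) 0 y M hy.1 hyM le_rfl (by simpa using hk)
    simp at h
    have h3 : β * F j M ≤ β * F j y := by gcongr
    have : 0 ≤ (β * γ) * ((1 - β * γ) * p * (M - x)) := by positivity
    nlinarith
  · push Not at hk
    have h := H.glue hj (hF.pa j hj hjL) 0 (M - s) M (by linarith [hy.1]) (by linarith) le_rfl
      (by simp [hM])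
    have h' := H.glue hj (hF.pa j hj hjL) 1 y (M - s) hy.1 hk.le (by linarith)
      (by push_cast; nlinarith [H.g1])
    simp at h h'
    have e : M - s - y = γ * (M - x) - s := by linarith
    rw [e] at h'
    have h3 : β * (F j M - F j y) ≤ β * ((1 - β * γ) * p * (γ * (M - x) - s)) := by
      gcongr; linarith
    have h4 : 0 ≤ ((1 - β * γ) * p) * β * (s - γ * (M - x) / 2) := by
      apply mul_nonneg (by positivity)
      nlinarith [H.g1]
    nlinarith

/-- the value of going directly to threshold `j`. -/
noncomputable def Vv (β γ p r δ s : ℝ) (F : ℕ → ℝ → ℝ) (j : ℕ) : ℝ :=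
  (1 - β * γ) * p * (s * ((j : ℝ) - 1)) - (r + β * p * δ) * ((j : ℝ) - 1)
    + β * F j (s * ((j : ℝ) - 1))

theorem Hyp.V_succ (H : Hyp β γ p m r δ s L) (hF : FHyp β γ p δ L F) {j : ℕ} (hj : 1 ≤ j)
    (hjL : j < L) : Vv β γ p r δ s F (j + 1) ≤ Vv β γ p r δ s F j := by
  have h := hF.pb j hj hjL
  rw [H.mu hj, H.mu (by omega)] at h
  have h3 := mul_le_mul_of_nonneg_left h H.b0.le
  have hr := H.hr
  unfold Vv
  rw [H.hd]
  push_cast at *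
  nlinarith

/-- general lower-bound/cases view of the option set, using target level. -/
def Opt (β γ p m r δ s : ℝ) (L : ℕ) (F : ℕ → ℝ → ℝ) (l : ℕ) (x v : ℝ) : Prop :=
  ∃ j : ℕ, ∃ xt u : ℝ, 1 ≤ j ∧ j ≤ L ∧ x ≤ xt ∧ xt ≤ s * ((L : ℝ) - 1) ∧ 0 ≤ u ∧
    ((j + 1 = l ∧ xt + u < s * ((l : ℝ) - 1)) ∨
     (j = l ∧ s * ((l : ℝ) - 1) ≤ xt + u ∧ (l < L → xt + u < s * (l : ℝ))) ∨
     (j = l + 1 ∧ s * (l : ℝ) ≤ xt + u)) ∧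
    v = (1 - β * γ) * p * xt + m * u - (r + β * p * δ) * ((j : ℝ) - 1)
          + β * F j (γ * xt + δ * ((j : ℝ) - 1))

theorem Hyp.bell (H : Hyp β γ p m r δ s L) {l : ℕ} (hl : 1 ≤ l) (hlL : l ≤ L) (x : ℝ) :
    mlBell β γ p m r δ L (natThresh γ δ) F l x = sInf {v | Opt β γ p m r δ s L F l x v} := by
  unfold mlBell
  congr 1
  ext v
  have hL := H.hL
  have e1 := H.mu (l := l) hl
  have e2 := H.mu (l := l + 1) (by omega)
  have e3 := H.mu (l := L) (by omega)
  have e4 : s * (((l + 1 : ℕ) : ℝ) - 1) = s * (l : ℝ) := by push_cast; ring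
  simp only [Set.mem_ofPred_eq, e1, e2, e3, e4]
  constructor
  · rintro (⟨xt, u, h1, h2, h3, h4, h5, rfl⟩ | ⟨xt, u, h1, h2, h3, h4, h5, rfl⟩ |
      ⟨xt, u, h1, h2, h3, h4, h5, rfl⟩)
    · refine ⟨l - 1, xt, u, by omega, by omega, h1, h2, h3, Or.inl ⟨by omega, h5⟩, ?_⟩
      have : (((l - 1 : ℕ) : ℝ) - 1) = (l : ℝ) - 2 := by
        rw [Nat.cast_sub hl]; push_cast; ring
      rw [this]
    · exact ⟨l, xt, u, hl, hlL, h1, h2, h3, Or.inr (Or.inl ⟨rfl, h4, h5⟩), rfl⟩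
    · refine ⟨l + 1, xt, u, by omega, by omega, h1, h2, h3, Or.inr (Or.inr ⟨rfl, h5⟩), ?_⟩
      have : (((l + 1 : ℕ) : ℝ) - 1) = (l : ℝ) := by push_cast; ring
      rw [this]
  · rintro ⟨j, xt, u, hj, hjL, h1, h2, h3, (⟨rfl, h4⟩ | ⟨rfl, h4, h5⟩ | ⟨rfl, h4⟩), rfl⟩
    · left
      refine ⟨xt, u, h1, h2, h3, by omega, h4, ?_⟩
      have : (((j + 1 : ℕ) : ℝ) - 2) = (j : ℝ) - 1 := by push_cast; ring
      rw [this]; rfl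
    · exact Or.inr (Or.inl ⟨xt, u, h1, h2, h3, h4, h5, rfl⟩)
    · right; right
      refine ⟨xt, u, h1, h2, h3, by omega, h4, ?_⟩
      have : (((l + 1 : ℕ) : ℝ) - 1) = (l : ℝ) := by push_cast; ring
      rw [this]

theorem Hyp.bdd (H : Hyp β γ p m r δ s L) (hF : FHyp β γ p δ L F) {l : ℕ} {x : ℝ}
    (hx : 0 ≤ x) : BddBelow {v | Opt β γ p m r δ s L F l x v} := by
  set c : ℕ → ℝ := fun j => - (r + β * p * δ) * ((j : ℝ) - 1) + β * F j 0 with hc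
  refine ⟨min (c (l - 1)) (min (c l) (c (l + 1))), ?_⟩
  rintro v ⟨j, xt, u, hj, hjL, h1, h2, h3, h4, rfl⟩
  have hcj : min (c (l - 1)) (min (c l) (c (l + 1))) ≤ c j := by
    rcases h4 with (⟨rfl, h4⟩ | ⟨rfl, h4, h5⟩ | ⟨rfl, h4⟩)
    · exact min_le_left _ _
    · exact (min_le_right _ _).trans (min_le_left _ _)
    · exact (min_le_right _ _).trans (min_le_right _ _)
  refine hcj.trans ?_
  have hy := H.step_range hj hjL (hx.trans h1) h2
  have h5 : F j 0 ≤ F j (γ * xt + δ * ((j : ℝ) - 1)) :=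
    hF.mono j hj hjL ⟨le_rfl, hy.1.trans hy.2⟩ hy hy.1
  have h6 := mul_le_mul_of_nonneg_left h5 H.b0.le
  have h7 : 0 ≤ m * u := mul_nonneg H.m0.le h3
  have h8 : 0 ≤ (1 - β * γ) * p * xt :=
    mul_nonneg (mul_nonneg (by linarith [H.a1]) H.p0.le) (hx.trans h1)
  simp only [hc]
  linarith

theorem Hyp.nonempty (H : Hyp β γ p m r δ s L) {l : ℕ} (hl : 1 ≤ l) (hlL : l ≤ L) {x : ℝ}
    (hx : x ≤ s * ((L : ℝ) - 1)) : {v | Opt β γ p m r δ s L F l x v}.Nonempty := by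
  have hs := H.s0
  rcases hlL.lt_or_eq with h | rfl
  · refine ⟨_, l + 1, s * ((L : ℝ) - 1), 0, by omega, by omega, hx, le_rfl, le_rfl,
      Or.inr (Or.inr ⟨rfl, ?_⟩), rfl⟩
    have : ((l + 1 : ℕ) : ℝ) ≤ L := by exact_mod_cast h
    push_cast at this
    rw [add_zero]
    gcongr
    linarith
  · exact ⟨_, l, s * ((l : ℝ) - 1), 0, hl, le_rfl, hx, le_rfl, le_rfl,
      Or.inr (Or.inl ⟨rfl, by simp, fun h => absurd h (lt_irrefl _)⟩), rfl⟩

theorem Hyp.bell_le (H : Hyp β γ p m r δ s L) (hF : FHyp β γ p δ L F) {l : ℕ} (hl : 1 ≤ l)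
    (hlL : l ≤ L) {x v : ℝ} (hx : 0 ≤ x) (hv : Opt β γ p m r δ s L F l x v) :
    mlBell β γ p m r δ L (natThresh γ δ) F l x ≤ v := by
  rw [H.bell hl hlL]
  exact csInf_le (H.bdd hF hx) hv

theorem Hyp.le_bell (H : Hyp β γ p m r δ s L) {l : ℕ} (hl : 1 ≤ l)
    (hlL : l ≤ L) {x c : ℝ} (hx : x ≤ s * ((L : ℝ) - 1))
    (hc : ∀ v, Opt β γ p m r δ s L F l x v → c ≤ v) :
    c ≤ mlBell β γ p m r δ L (natThresh γ δ) F l x := by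
  rw [H.bell hl hlL]
  exact le_csInf (H.nonempty hl hlL hx) hc

theorem Hyp.V_le (H : Hyp β γ p m r δ s L) (hF : FHyp β γ p δ L F) {j : ℕ} (hj : 1 ≤ j)
    (hjL : j ≤ L) {x u : ℝ} (hx : 0 ≤ x) (hxL : x ≤ s * ((L : ℝ) - 1)) (hu : 0 ≤ u)
    (hxu : s * ((j : ℝ) - 1) ≤ x + u) (hd : s * ((j : ℝ) - 1) - 2 * s ≤ x) :
    Vv β γ p r δ s F j ≤ (1 - β * γ) * p * x + m * u - (r + β * p * δ) * ((j : ℝ) - 1)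
          + β * F j (γ * x + δ * ((j : ℝ) - 1)) := by
  have := H.lemA hF hj hjL hx hxL hu hxu hd
  unfold Vv
  linarith

theorem Hyp.V_eq (H : Hyp β γ p m r δ s L) (j : ℕ) :
    Vv β γ p r δ s F j = (1 - β * γ) * p * (s * ((j : ℝ) - 1)) + m * 0
      - (r + β * p * δ) * ((j : ℝ) - 1)
          + β * F j (γ * (s * ((j : ℝ) - 1)) + δ * ((j : ℝ) - 1)) := by
  have : γ * (s * ((j : ℝ) - 1)) + δ * ((j : ℝ) - 1) = s * ((j : ℝ) - 1) := by
    rw [H.hd]; ring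
  rw [this]
  unfold Vv
  ring

theorem Hyp.const_lt (H : Hyp β γ p m r δ s L) (hF : FHyp β γ p δ L F) {l : ℕ} (hl : 1 ≤ l)
    (hlL : l < L) {x : ℝ} (hx : 0 ≤ x) (hx1 : s * ((l : ℝ) - 1) - s ≤ x) (hx2 : x ≤ s * (l : ℝ)) :
    mlBell β γ p m r δ L (natThresh γ δ) F l x = Vv β γ p r δ s F (l + 1) := by
  have hs := H.s0
  have hlR : (l : ℝ) + 1 ≤ L := by exact_mod_cast hlL
  have hmL : s * (l : ℝ) ≤ s * ((L : ℝ) - 1) := by gcongr; linarith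
  have ec : (((l + 1 : ℕ) : ℝ) - 1) = (l : ℝ) := by push_cast; ring
  apply le_antisymm
  · apply H.bell_le hF hl hlL.le hx
    refine ⟨l + 1, s * (((l + 1 : ℕ) : ℝ) - 1), 0, by omega, by omega, by rwa [ec],
      by rwa [ec], le_rfl, Or.inr (Or.inr ⟨rfl, by rw [ec]; simp⟩), H.V_eq _⟩
  · apply H.le_bell hl hlL.le (hx2.trans hmL)
    rintro v ⟨j, xt, u, hj, hjL, h1, h2, h3, h4, rfl⟩
    rcases h4 with (⟨rfl, h4⟩ | ⟨rfl, h4, h5⟩ | ⟨rfl, h4⟩)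
    · refine ((H.V_succ hF (by omega) hlL).trans (H.V_succ hF hj (by omega))).trans ?_
      push_cast at hx1
      apply H.V_le hF hj hjL (hx.trans h1) h2 h3 <;> nlinarith
    · refine (H.V_succ hF hj hlL).trans ?_
      apply H.V_le hF hj hjL (hx.trans h1) h2 h3 h4
      nlinarith
    · apply H.V_le hF hj hjL (hx.trans h1) h2 h3
      · rwa [ec]
      · rw [ec]; nlinarith

theorem Hyp.const_L (H : Hyp β γ p m r δ s L) (hF : FHyp β γ p δ L F) {x : ℝ}
    (hx : 0 ≤ x) (hx1 : s * ((L : ℝ) - 1) - s ≤ x) (hx2 : x ≤ s * ((L : ℝ) - 1)) :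
    mlBell β γ p m r δ L (natThresh γ δ) F L x = Vv β γ p r δ s F L := by
  have hs := H.s0
  have hL := H.hL
  apply le_antisymm
  · apply H.bell_le hF (by omega) le_rfl hx
    exact ⟨L, s * ((L : ℝ) - 1), 0, by omega, le_rfl, hx2, le_rfl, le_rfl,
      Or.inr (Or.inl ⟨rfl, by simp, fun h => absurd h (lt_irrefl _)⟩), H.V_eq _⟩
  · apply H.le_bell (by omega) le_rfl hx2
    rintro v ⟨j, xt, u, hj, hjL, h1, h2, h3, h4, rfl⟩
    rcases h4 with (⟨rfl, h4⟩ | ⟨rfl, h4, h5⟩ | ⟨rfl, h4⟩)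
    · refine (H.V_succ hF hj (by omega)).trans ?_
      push_cast at hx1
      apply H.V_le hF hj hjL (hx.trans h1) h2 h3 <;> nlinarith
    · apply H.V_le hF hj hjL (hx.trans h1) h2 h3 h4
      nlinarith
    · omega

theorem Hyp.above (H : Hyp β γ p m r δ s L) (hF : FHyp β γ p δ L F) {l : ℕ} (hl : 1 ≤ l)
    (hlL : l < L) {x : ℝ} (hx1 : s * (l : ℝ) ≤ x) (hx2 : x ≤ s * ((L : ℝ) - 1)) :
    mlBell β γ p m r δ L (natThresh γ δ) F l x =
      (1 - β * γ) * p * x + m * 0 - (r + β * p * δ) * (((l + 1 : ℕ) : ℝ) - 1)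
          + β * F (l + 1) (γ * x + δ * (((l + 1 : ℕ) : ℝ) - 1)) := by
  have hs := H.s0
  have hx : 0 ≤ x := le_trans (by positivity) hx1
  apply le_antisymm
  · apply H.bell_le hF hl hlL.le hx
    exact ⟨l + 1, x, 0, by omega, by omega, le_rfl, hx2, le_rfl,
      Or.inr (Or.inr ⟨rfl, by simpa using hx1⟩), rfl⟩
  · apply H.le_bell hl hlL.le hx2
    rintro v ⟨j, xt, u, hj, hjL, h1, h2, h3, h4, rfl⟩
    rcases h4 with (⟨rfl, h4⟩ | ⟨rfl, h4, h5⟩ | ⟨rfl, h4⟩)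
    · push_cast at h4 hx1
      nlinarith
    · have := h5 hlL
      linarith
    · have hy := H.step_range hj hjL (hx.trans h1) h2
      have hy' := H.step_range hj hjL hx hx2
      have hg := H.g0
      have h5 := hF.mono _ hj hjL hy' hy (by gcongr)
      have h6 := mul_le_mul_of_nonneg_left h5 H.b0.le
      have h7 : m * 0 ≤ m * u := mul_le_mul_of_nonneg_left h3 H.m0.le
      have h8 : (1 - β * γ) * p * x ≤ (1 - β * γ) * p * xt :=
        mul_le_mul_of_nonneg_left h1 (mul_nonneg (by linarith [H.a1]) H.p0.le)
      linarith

theorem Hyp.bell_mono (H : Hyp β γ p m r δ s L) (hF : FHyp β γ p δ L F) {l : ℕ} (hl : 1 ≤ l)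
    (hlL : l ≤ L) {x y : ℝ} (hx : 0 ≤ x) (hxy : x ≤ y) (hy : y ≤ s * ((L : ℝ) - 1)) :
    mlBell β γ p m r δ L (natThresh γ δ) F l x ≤ mlBell β γ p m r δ L (natThresh γ δ) F l y := by
  apply H.le_bell hl hlL hy
  rintro v ⟨j, xt, u, hj, hjL, h1, h⟩
  exact H.bell_le hF hl hlL hx ⟨j, xt, u, hj, hjL, hxy.trans h1, h⟩

/-- increment bound for the continuation value -/
theorem Hyp.incr (H : Hyp β γ p m r δ s L) (hF : FHyp β γ p δ L F) {j : ℕ} (hj : 1 ≤ j)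
    (hjL : j ≤ L) (k : ℕ) {x y : ℝ} (hx : 0 ≤ x) (hxy : x ≤ y) (hy : y ≤ s * ((j : ℝ) - 1))
    (hk : s * ((j : ℝ) - 1) - (k + 1) * s ≤ x) :
    (1 - β * γ) * p * y + β * F j (γ * y + δ * ((j : ℝ) - 1)) -
     ((1 - β * γ) * p * x + β * F j (γ * x + δ * ((j : ℝ) - 1)))
      ≤ (1 - (β * γ) ^ (k + 1)) * p * (y - x) := by
  have hg := H.g0
  have hyL := (H.mu_range hj hjL).2
  rw [H.mu (by have := H.hL; omega)] at hyL
  have h0 := H.step_range hj hjL hx (by linarith)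
  have hks : 0 ≤ ((k : ℝ) + 1) * s := mul_nonneg (by positivity) H.s0.le
  have h := H.glue hj (hF.pa j hj hjL) k (γ * x + δ * ((j : ℝ) - 1)) (γ * y + δ * ((j : ℝ) - 1))
    h0.1 (by gcongr) (by rw [H.stepeq]; nlinarith) (by rw [H.stepeq]; nlinarith [H.g1])
  have h3 := mul_le_mul_of_nonneg_left h H.b0.le
  have e : β * ((1 - (β * γ) ^ k) * p * (γ * y + δ * ((j : ℝ) - 1) - (γ * x + δ * ((j : ℝ) - 1))))
    = ((1 - (β * γ) ^ (k + 1)) - (1 - β * γ)) * p * (y - x) := by ring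
  rw [e] at h3
  linarith

theorem Hyp.bell_lip (H : Hyp β γ p m r δ s L) (hF : FHyp β γ p δ L F) {l : ℕ} (hl : 1 ≤ l)
    (hlL : l ≤ L) (k : ℕ) (hk1 : 1 ≤ k) {x y : ℝ} (hx : 0 ≤ x) (hxy : x ≤ y)
    (hy : y ≤ s * ((l : ℝ) - 1) - k * s) (hk : s * ((l : ℝ) - 1) - (k + 1) * s ≤ x) :
    mlBell β γ p m r δ L (natThresh γ δ) F l y - mlBell β γ p m r δ L (natThresh γ δ) F l x
      ≤ (1 - (β * γ) ^ k) * p * (y - x) := by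
  have hs := H.s0
  have ha0 := H.a0
  have ha1 := H.a1
  have hp := H.p0
  have hk1R : (1 : ℝ) ≤ k := by exact_mod_cast hk1
  have hlR : (l : ℝ) ≤ L := by exact_mod_cast hlL
  have hlL' : s * ((l : ℝ) - 1) ≤ s * ((L : ℝ) - 1) := by gcongr
  have hks : s ≤ k * s := by nlinarith
  have hpow : (β * γ) ^ k ≤ β * γ := by
    have := pow_le_pow_of_le_one ha0.le ha1.le hk1
    simpa using this
  have hpow0 : 0 < (β * γ) ^ k := pow_pos ha0 k
  have hpow1 : 0 ≤ 1 - (β * γ) ^ k := by linarith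
  suffices h : mlBell β γ p m r δ L (natThresh γ δ) F l y - (1 - (β * γ) ^ k) * p * (y - x) ≤
    mlBell β γ p m r δ L (natThresh γ δ) F l x by linarith
  apply H.le_bell hl hlL (by linarith)
  rintro v ⟨j, xt, u, hj, hjL, h1, h2, h3, h4, rfl⟩
  by_cases hxt : y ≤ xt
  · have h5 := H.bell_le hF hl hlL (hx.trans hxy) ⟨j, xt, u, hj, hjL, hxt, h2, h3, h4, rfl⟩
    have : 0 ≤ (1 - (β * γ) ^ k) * p * (y - x) :=
      mul_nonneg (mul_nonneg hpow1 hp.le) (by linarith)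
    linarith
  push Not at hxt
  have h6 : (1 - (β * γ) ^ k) * p * (y - xt) ≤ (1 - (β * γ) ^ k) * p * (y - x) := by gcongr
  have hy0 : 0 ≤ y := hx.trans hxy
  have hx0 : 0 ≤ xt := hx.trans h1
  have hm := H.m0
  rcases h4 with (⟨rfl, h4⟩ | ⟨rfl, h4, h5⟩ | ⟨rfl, h4⟩)
  · push_cast at hy hk hlL' h4
    have h7 := H.bell_le hF hl hlL hy0 (v := _)
      ⟨j, y, 0, hj, hjL, le_rfl, by linarith, le_rfl, Or.inl ⟨rfl, by push_cast; linarith⟩, rfl⟩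
    obtain ⟨q, rfl⟩ : ∃ q, k = q + 1 := ⟨k - 1, by omega⟩
    push_cast at hy hk
    have h8 := H.incr hF hj hjL q hx0 hxt.le (by nlinarith) (by nlinarith)
    have h9 : 0 ≤ m * u := by positivity
    linarith
  · have h7 := H.bell_le hF hl hlL hy0 (v := _)
      ⟨j, y, u - (y - xt), hj, hjL, le_rfl, by linarith, by linarith,
        Or.inr (Or.inl ⟨rfl, by linarith, fun h => by have := h5 h; linarith⟩), rfl⟩
    have h8 := H.incr hF hj hjL k hx0 hxt.le (by linarith) (by linarith)
    have h9 : (1 - (β * γ) ^ (k + 1)) * p - m ≤ (1 - (β * γ) ^ k) * p := by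
      have hm1 := H.m1
      have e1 : (β * γ) ^ k * ((1 - β * γ) * p) ≤ 1 * ((1 - β * γ) * p) := by
        apply mul_le_mul_of_nonneg_right (by linarith) (mul_nonneg (by linarith) hp.le)
      have e2 : 0 ≤ β * γ * ((1 - β * γ) * p) :=
        mul_nonneg ha0.le (mul_nonneg (by linarith) hp.le)
      rw [pow_succ]
      nlinarith
    have h10 := mul_le_mul_of_nonneg_right h9 (by linarith : 0 ≤ y - xt)
    linarith
  · have ec : (((l + 1 : ℕ) : ℝ) - 1) = (l : ℝ) := by push_cast; ring
    have h7 := H.bell_le hF hl hlL hy0 (v := _)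
      ⟨l + 1, y, u - (y - xt), hj, hjL, le_rfl, by linarith, by linarith,
        Or.inr (Or.inr ⟨rfl, by linarith⟩), rfl⟩
    have h8 := H.incr hF hj hjL (k + 1) hx0 hxt.le (by rw [ec]; linarith)
      (by rw [ec]; push_cast; linarith)
    have h9 : (1 - (β * γ) ^ (k + 1 + 1)) * p - m ≤ (1 - (β * γ) ^ k) * p := by
      have hm1 := H.m2
      have e1 : (β * γ) ^ k * ((1 - (β * γ) ^ 2) * p) ≤ (β * γ) * ((1 - (β * γ) ^ 2) * p) := by
        apply mul_le_mul_of_nonneg_right hpow (mul_nonneg (by nlinarith) hp.le)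
      rw [pow_succ, pow_succ]
      nlinarith
    have h10 := mul_le_mul_of_nonneg_right h9 (by linarith : 0 ≤ y - xt)
    linarith

theorem Hyp.bell_pa (H : Hyp β γ p m r δ s L) (hF : FHyp β γ p δ L F) {l : ℕ} (hl : 1 ≤ l)
    (hlL : l ≤ L) : PaL β γ p δ l (mlBell β γ p m r δ L (natThresh γ δ) F l) := by
  have hs := H.s0
  have hlR : (l : ℝ) ≤ L := by exact_mod_cast hlL
  have hlL' : s * ((l : ℝ) - 1) ≤ s * ((L : ℝ) - 1) := by gcongr
  have key : ∀ k : ℕ, k < l → ∀ x y : ℝ, natThresh γ δ (l - k - 1) ≤ x → x ≤ y →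
      y ≤ natThresh γ δ (l - k) →
      |mlBell β γ p m r δ L (natThresh γ δ) F l y - mlBell β γ p m r δ L (natThresh γ δ) F l x|
        ≤ (1 - (β * γ) ^ k) * p * |y - x| := by
    intro k hk x y hx hxy hy
    have e1 : natThresh γ δ (l - k) = s * ((l : ℝ) - 1) - k * s := by
      rw [H.mu (by omega), Nat.cast_sub hk.le]; ring
    rw [e1] at hy
    have hkl : (k : ℝ) + 1 ≤ l := by exact_mod_cast hk
    have hks : 0 ≤ (k : ℝ) * s := by positivity
    have e2 : 0 ≤ x ∧ s * ((l : ℝ) - 1) - (k + 1) * s ≤ x := by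
      by_cases h : l - k - 1 = 0
      · rw [h, Hyp.mu0] at hx
        have : (l : ℝ) ≤ k + 1 := by exact_mod_cast (by omega : l ≤ k + 1)
        exact ⟨hx, by nlinarith⟩
      · have : (k : ℝ) + 1 + 1 ≤ l := by exact_mod_cast (by omega : k + 1 + 1 ≤ l)
        rw [H.mu (by omega), Nat.cast_sub (by omega), Nat.cast_sub hk.le] at hx
        push_cast at hx
        constructor <;> nlinarith
    obtain ⟨hx0, hx1⟩ := e2
    have hmono := H.bell_mono hF hl hlL hx0 hxy (by linarith)
    rw [abs_of_nonneg (by linarith), abs_of_nonneg (by linarith : 0 ≤ y - x)]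
    rcases Nat.eq_zero_or_pos k with rfl | hk1
    · simp only [Nat.cast_zero, zero_mul, zero_add, one_mul, sub_zero] at hx1 hy
      rcases hlL.lt_or_eq with h | rfl
      · rw [H.const_lt hF hl h hx0 hx1 (by linarith), H.const_lt hF hl h (hx0.trans hxy)
          (by linarith) (by linarith)]
        simp
      · rw [H.const_L hF hx0 hx1 (by linarith), H.const_L hF (hx0.trans hxy)
          (by linarith) (by linarith)]
        simp
    · exact H.bell_lip hF hl hlL k hk1 hx0 hxy hy hx1
  intro k hk x hx y hy
  rcases le_total x y with h | h
  · rw [abs_sub_comm, abs_sub_comm x y]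
    exact key k hk x y hx.1 h hy.2
  · exact key k hk y x hy.1 h hx.2

theorem Hyp.bell_cont (H : Hyp β γ p m r δ s L) (hF : FHyp β γ p δ L F) {l : ℕ} (hl : 1 ≤ l)
    (hlL : l ≤ L) : ContinuousOn (mlBell β γ p m r δ L (natThresh γ δ) F l)
      (Set.Icc 0 (natThresh γ δ L)) := by
  have hs := H.s0
  have hp := H.p0
  have hL := H.hL
  have hlR : (l : ℝ) ≤ L := by exact_mod_cast hlL
  have hl1 : (1 : ℝ) ≤ l := by exact_mod_cast hl
  have hlL' : s * ((l : ℝ) - 1) ≤ s * ((L : ℝ) - 1) := by gcongr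
  rw [H.mu (by omega)]
  have c1 : ContinuousOn (mlBell β γ p m r δ L (natThresh γ δ) F l)
      (Set.Icc 0 (s * ((l : ℝ) - 1))) := by
    have : LipschitzOnWith (Real.toNNReal p) (mlBell β γ p m r δ L (natThresh γ δ) F l)
      (Set.Icc 0 (s * ((l : ℝ) - 1))) := by
      apply LipschitzOnWith.of_le_add_mul
      intro x hx y hy
      rw [Real.coe_toNNReal _ hp.le, Real.dist_eq]
      rcases le_total x y with h | h
      · have := H.bell_mono hF hl hlL hx.1 h (by linarith [hy.2])
        have : 0 ≤ p * |x - y| := by positivity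
        linarith
      · have h1 := H.glue hl (H.bell_pa hF hl hlL) l y x hy.1 h hx.2 (by nlinarith [hy.1])
        rw [abs_of_nonneg (by linarith)]
        have h2 : 0 < (β * γ) ^ l := pow_pos H.a0 _
        have h3 : 0 ≤ p * (x - y) := mul_nonneg hp.le (by linarith)
        nlinarith
    exact this.continuousOn
  rcases hlL.lt_or_eq with h | rfl
  · have hlL2 : (l : ℝ) + 1 ≤ L := by exact_mod_cast h
    have hlL3 : s * (l : ℝ) ≤ s * ((L : ℝ) - 1) := by gcongr; linarith
    have c2 : ContinuousOn (mlBell β γ p m r δ L (natThresh γ δ) F l)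
      (Set.Icc (s * ((l : ℝ) - 1)) (s * (l : ℝ))) := by
      apply (continuousOn_const (c := Vv β γ p r δ s F (l + 1))).congr
      intro x hx
      have : 0 ≤ s * ((l : ℝ) - 1) := mul_nonneg hs.le (by linarith)
      exact H.const_lt hF hl h (this.trans hx.1) (by linarith [hx.1]) hx.2
    have c3 : ContinuousOn (mlBell β γ p m r δ L (natThresh γ δ) F l)
      (Set.Icc (s * (l : ℝ)) (s * ((L : ℝ) - 1))) := by
      refine ContinuousOn.congr ?_ (fun x hx => H.above hF hl h hx.1 hx.2)
      have hm : Set.MapsTo (fun x : ℝ => γ * x + δ * (((l + 1 : ℕ) : ℝ) - 1))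
        (Set.Icc (s * (l : ℝ)) (s * ((L : ℝ) - 1))) (Set.Icc 0 (natThresh γ δ L)) := by
        intro x hx
        exact H.step_range (by omega) h (le_trans (by positivity) hx.1) hx.2
      have hc := (hF.cont (l + 1) (by omega) h).comp (by fun_prop) hm
      have hc2 : ContinuousOn (fun x : ℝ => F (l + 1) (γ * x + δ * (((l + 1 : ℕ) : ℝ) - 1)))
        (Set.Icc (s * (l : ℝ)) (s * ((L : ℝ) - 1))) := hc
      exact ContinuousOn.add (by fun_prop) (continuousOn_const.mul hc2)
    have h12 := c1.union_of_isClosed c2 isClosed_Icc isClosed_Icc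
    rw [Set.Icc_union_Icc_eq_Icc (mul_nonneg hs.le (by linarith)) (by nlinarith)] at h12
    have h123 := h12.union_of_isClosed c3 isClosed_Icc isClosed_Icc
    rwa [Set.Icc_union_Icc_eq_Icc (by positivity) hlL3] at h123
  · exact c1

end

/-- The invariance lemma at the core of Theorem 4.2 part (2): under the stated
conditions and with the natural thresholds `μ_l = δ(l-1)/(1-γ)`, the multi-level Bellman
operator maps the class `𝓕` into itself, and on each promotion region
`[μ_{max(l-1,1)}, μ_{l+1}]` the updated value equals
`(1-βγ)c⁺μ_{l+1} - (r + βc⁺δ)·l + β·F(l+1, μ_{l+1})`. -/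
theorem stmt_14 (β γ cplus cminus r δ : ℝ) (L : ℕ)
    (hβ : β ∈ Set.Ioo (0:ℝ) 1) (hγ : γ ∈ Set.Ioo (0:ℝ) 1)
    (hδ : 0 < δ) (hcm : 0 < cminus) (hcmcp : cminus < cplus)
    (hr : (1 - β) * cplus * δ / (1 - γ) ≤ r)
    (hcm2 : max ((1 + β * γ / 2) * (1 - β * γ) * cplus)
        (β * γ * (1 - β ^ 2 * γ ^ 2) * cplus) ≤ cminus)
    (hL : 2 ≤ L) :
    ∀ F : ℕ → ℝ → ℝ, memInvClass β γ cplus L (natThresh γ δ) F →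
      memInvClass β γ cplus L (natThresh γ δ) (mlBell β γ cplus cminus r δ L (natThresh γ δ) F)
      ∧ ∀ l : ℕ, 1 ≤ l → l < L →
          ∀ x ∈ Set.Icc (natThresh γ δ (max (l - 1) 1)) (natThresh γ δ (l + 1)),
            mlBell β γ cplus cminus r δ L (natThresh γ δ) F l x
              = (1 - β * γ) * cplus * natThresh γ δ (l + 1) - (r + β * cplus * δ) * (l : ℝ)
                + β * F (l + 1) (natThresh γ δ (l + 1)) := by
  intro F hF0
  have hg1 : 0 < 1 - γ := by linarith [hγ.2]
  have H : Hyp β γ cplus cminus r δ (δ / (1 - γ)) L :=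
    { b0 := hβ.1, b1 := hβ.2, g0 := hγ.1, g1 := hγ.2, s0 := by positivity
      hd := by field_simp
      p0 := hcm.trans hcmcp, m0 := hcm
      m1 := (le_max_left _ _).trans hcm2
      m2 := (le_max_right _ _).trans hcm2
      hr := by rw [← mul_div_assoc]; exact hr
      hL := hL }
  have hF : FHyp β γ cplus δ L F :=
    { cont := fun l h1 h2 => (hF0.1 l (Finset.mem_Icc.2 ⟨h1, h2⟩)).1
      mono := fun l h1 h2 => (hF0.1 l (Finset.mem_Icc.2 ⟨h1, h2⟩)).2
      pa := fun l h1 h2 => hF0.2.1 l (Finset.mem_Icc.2 ⟨h1, h2⟩)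
      pb := hF0.2.2 }
  have hs := H.s0
  refine ⟨⟨?_, ?_, ?_⟩, ?_⟩
  · intro l hl
    obtain ⟨h1, h2⟩ := Finset.mem_Icc.1 hl
    refine ⟨H.bell_cont hF h1 h2, ?_⟩
    intro x hx y hy hxy
    exact H.bell_mono hF h1 h2 hx.1 hxy (by rw [← H.mu (by omega)]; exact hy.2)
  · intro l hl
    obtain ⟨h1, h2⟩ := Finset.mem_Icc.1 hl
    exact H.bell_pa hF h1 h2
  · intro l h1 h2
    have hl1 : (1 : ℝ) ≤ l := by exact_mod_cast h1
    have h0 : 0 ≤ δ / (1 - γ) * ((l : ℝ) - 1) := mul_nonneg hs.le (by linarith)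
    rw [H.mu h1, H.mu (l := l + 1) (by omega), H.const_lt hF h1 h2 h0 (by linarith) (by nlinarith)]
    have ec : (((l + 1 : ℕ) : ℝ) - 1) = (l : ℝ) := by push_cast; ring
    rcases (Nat.succ_le_of_lt h2).lt_or_eq with h | h
    · rw [H.const_lt hF (l := l + 1) (by omega) h]
      · exact H.V_succ hF (by omega) h
      · rw [ec]; positivity
      · linarith
      · push_cast; nlinarith
    · have h' : l + 1 = L := h
      subst h'
      rw [H.const_L hF]
      · rw [ec]; positivity
      · linarith
      · exact le_rfl
  · intro l h1 h2 x hx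
    have ec : (((l + 1 : ℕ) : ℝ) - 1) = (l : ℝ) := by push_cast; ring
    rw [H.mu (by omega), H.mu (l := l + 1) (by omega), ec] at hx
    rw [H.mu (l := l + 1) (by omega)]
    have hm1 : (1 : ℝ) ≤ (max (l - 1) 1 : ℕ) := by exact_mod_cast le_max_right _ _
    have hm2 : (l : ℝ) ≤ (max (l - 1) 1 : ℕ) + 1 := by
      exact_mod_cast (by omega : l ≤ max (l - 1) 1 + 1)
    rw [H.const_lt hF h1 h2 (le_trans (mul_nonneg hs.le (by linarith)) hx.1)
      (le_trans (by nlinarith) hx.1) hx.2]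
    unfold Vv
    rw [ec]
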